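/- Let A be a real 2d×2d symplectic matrix with ker(I − A) ∩ im(I − A) = {0}, and let w₀ ∈ ℝ^{2d} satisfy Aw₀ = w₀. Then there exists a constant C > 0 such that for every u ∈ im(I − A) and every τ ∈ ℝ one has Re S_A(u, τw₀ + u) = −((A − I)u − τw₀)ᵗ 𝒫_A ((A − I)u − τw₀) ≤ −C(‖u‖² + τ²‖w₀‖²), where ‖·‖ is the Euclidean norm on ℝ^{2d}. -/

import Mathlib

open Matrix

noncomputable section

/-- Index type for `ℝ^{2d} ≅ ℝ^d ⊕ ℝ^d`. -/
abbrev Idx (d : ℕ) := Fin d ⊕ Fin d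

/-- The matrix `J₀ = [[0, -I_d],[I_d, 0]]` of the standard complex structure on `ℝ^{2d}`. -/
def J0 (d : ℕ) : Matrix (Idx d) (Idx d) ℝ := fromBlocks 0 (-1) 1 0

/-- The standard symplectic form `ω₀(r,s) = -rᵗ J₀ s` on `ℝ^{2d}`. -/
def omega0 {d : ℕ} (u v : Idx d → ℝ) : ℝ := -(u ⬝ᵥ (J0 d).mulVec v)

/-- A real `2d × 2d` matrix is symplectic if `Aᵗ J₀ A = J₀`. -/
def IsSymplectic {d : ℕ} (A : Matrix (Idx d) (Idx d) ℝ) : Prop :=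
  Aᵀ * J0 d * A = J0 d

/-- `𝒬_A := I + P²`, where `P` is the positive factor of the polar decomposition. -/
def QA {d : ℕ} (P : Matrix (Idx d) (Idx d) ℝ) : Matrix (Idx d) (Idx d) ℝ := 1 + P * P

/-- `𝒫_A := O 𝒬_A⁻¹ Oᵗ`. -/
def PA {d : ℕ} (O P : Matrix (Idx d) (Idx d) ℝ) : Matrix (Idx d) (Idx d) ℝ :=
  O * (QA P)⁻¹ * Oᵀ

/-- `ℛ_A := O (I − P²) 𝒬_A⁻¹ J₀ Oᵗ`. -/
def RA {d : ℕ} (O P : Matrix (Idx d) (Idx d) ℝ) : Matrix (Idx d) (Idx d) ℝ :=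
  O * (1 - P * P) * (QA P)⁻¹ * J0 d * Oᵀ

/-- `L_A(u,w) := A u − w`. -/
def LA {d : ℕ} (A : Matrix (Idx d) (Idx d) ℝ) (u w : Idx d → ℝ) : Idx d → ℝ :=
  A.mulVec u - w

/-- The quadratic phase
`S_A(u,w) := −L_A(u,w)ᵗ [𝒫_A + (i/2) ℛ_A] L_A(u,w) − i ω₀(Au, w)`. -/
def SA {d : ℕ} (A O P : Matrix (Idx d) (Idx d) ℝ) (u w : Idx d → ℝ) : ℂ :=
  -((LA A u w ⬝ᵥ (PA O P).mulVec (LA A u w) : ℝ) : ℂ)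
    - (Complex.I / 2) * ((LA A u w ⬝ᵥ (RA O P).mulVec (LA A u w) : ℝ) : ℂ)
    - Complex.I * ((omega0 (A.mulVec u) w : ℝ) : ℂ)

/-- The square of the sup norm is at most the sum of squares. -/
lemma sq_norm_le_dotProduct_self {ι : Type*} [Fintype ι] (x : ι → ℝ) :
    ‖x‖ ^ 2 ≤ x ⬝ᵥ x := by
  have h0 : 0 ≤ x ⬝ᵥ x := Finset.sum_nonneg fun i _ => mul_self_nonneg (x i)
  refine (Real.le_sqrt (norm_nonneg x) h0).1 ?_
  refine (pi_norm_le_iff_of_nonneg (Real.sqrt_nonneg _)).2 fun i => ?_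
  refine Real.le_sqrt_of_sq_le ?_
  rw [Real.norm_eq_abs, sq_abs, sq]
  exact Finset.single_le_sum (f := fun j => x j * x j)
    (fun j _ => mul_self_nonneg (x j)) (Finset.mem_univ i)

/-- The sum of squares is at most the number of coordinates times the squared sup norm. -/
lemma dotProduct_self_le_card_mul_sq_norm {ι : Type*} [Fintype ι] (x : ι → ℝ) :
    x ⬝ᵥ x ≤ Fintype.card ι * ‖x‖ ^ 2 := by
  have h : ∀ i ∈ Finset.univ, x i * x i ≤ ‖x‖ ^ 2 := fun i _ => by
    rw [← sq, ← sq_abs, ← Real.norm_eq_abs]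
    exact pow_le_pow_left₀ (norm_nonneg _) (norm_le_pi_norm x i) 2
  simpa [dotProduct, Finset.sum_const, nsmul_eq_mul] using Finset.sum_le_sum h

open scoped MatrixOrder in
/-- A positive definite form pulled back along an injective linear map from a product of two
subspaces is coercive. -/
lemma exists_coercive_of_posDef_of_injective {ι κ : Type*} [Fintype ι] [Fintype κ]
    {M : Matrix κ κ ℝ} (hM : M.PosDef) {V W : Submodule ℝ (ι → ℝ)}
    (f : V × W →ₗ[ℝ] (κ → ℝ)) (hf : Function.Injective f) :
    ∃ C > (0 : ℝ), ∀ z : V × W,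
      C * ((z.1 : ι → ℝ) ⬝ᵥ z.1 + (z.2 : ι → ℝ) ⬝ᵥ z.2) ≤ f z ⬝ᵥ M *ᵥ f z := by
  classical
  obtain ⟨B, hB⟩ := CStarAlgebra.nonneg_iff_eq_star_mul_self.1 hM.posSemidef.nonneg
  have hform : ∀ v : κ → ℝ, v ⬝ᵥ M *ᵥ v = (B *ᵥ v) ⬝ᵥ (B *ᵥ v) := fun v => by
    rw [hB, star_eq_conjTranspose, ← mulVec_mulVec, dotProduct_mulVec,
      conjTranspose_eq_transpose_of_trivial, vecMul_transpose]
  have hBker : ∀ v : κ → ℝ, B *ᵥ v = 0 → v = 0 := fun v hv => by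
    by_contra hne
    have := hM.dotProduct_mulVec_pos hne
    rw [star_trivial, hform, hv, dotProduct_zero] at this
    exact lt_irrefl _ this
  have hker : LinearMap.ker (B.mulVecLin ∘ₗ f) = ⊥ :=
    LinearMap.ker_eq_bot'.2 fun z hz => hf (by rw [map_zero]; exact hBker _ hz)
  obtain ⟨K, hK, hlip⟩ := (B.mulVecLin ∘ₗ f).exists_antilipschitzWith hker
  have hK' : (0 : ℝ) < K := hK
  set n : ℝ := Fintype.card ι + 1
  have hnpos : 0 < n := by positivity
  refine ⟨1 / (2 * n * K ^ 2), by positivity, fun z => ?_⟩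
  have hz : ‖z‖ ≤ K * ‖B *ᵥ f z‖ := by simpa using hlip.le_mul_dist z 0
  have hsq : ‖z‖ ^ 2 ≤ K ^ 2 * (f z ⬝ᵥ M *ᵥ f z) := by
    rw [hform]
    calc ‖z‖ ^ 2 ≤ (K * ‖B *ᵥ f z‖) ^ 2 := pow_le_pow_left₀ (norm_nonneg _) hz 2
      _ = K ^ 2 * ‖B *ᵥ f z‖ ^ 2 := mul_pow _ _ _
      _ ≤ _ := by gcongr; exact sq_norm_le_dotProduct_self _
  have hbound : ∀ x : ι → ℝ, ‖x‖ ≤ ‖z‖ → x ⬝ᵥ x ≤ n * ‖z‖ ^ 2 := fun x hx =>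
    (dotProduct_self_le_card_mul_sq_norm x).trans (by gcongr; linarith)
  have h1 := hbound z.1 (norm_fst_le z)
  have h2 := hbound z.2 (norm_snd_le z)
  rw [div_mul_eq_mul_div, one_mul, div_le_iff₀ (by positivity)]
  nlinarith

lemma posDef_PA {d : ℕ} {O P : Matrix (Idx d) (Idx d) ℝ} (hO : Oᵀ * O = 1) (hP : Pᵀ = P) :
    (PA O P).PosDef := by
  have hQ : (QA P).PosDef := by
    have h := Matrix.posSemidef_conjTranspose_mul_self P
    rw [conjTranspose_eq_transpose_of_trivial, hP] at h
    exact Matrix.PosDef.one.add_posSemidef h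
  have hO' : Function.Injective O.vecMul := fun x y hxy => by
    have h := congrArg (fun v => v ᵥ* Oᵀ) hxy
    simpa [vecMul_vecMul, mul_eq_one_comm.1 hO] using h
  simpa [PA] using hQ.inv.mul_mul_conjTranspose_same hO'

/-- Suppose `A` is symplectic with `ker(I − A) ∩ im(I − A) = {0}` and `A w₀ = w₀`. Then
there is `C > 0` such that for every `u ∈ im(I − A)` and every `τ ∈ ℝ`,
`Re S_A(u, τ w₀ + u) = −((A − I)u − τ w₀)ᵗ 𝒫_A ((A − I)u − τ w₀)
  ≤ −C (‖u‖² + τ² ‖w₀‖²)`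
(here `v ⬝ᵥ v = ‖v‖²` is the squared Euclidean norm). -/
theorem re_SA_coercive_estimate {d : ℕ} (hd : 1 ≤ d)
    (A O P : Matrix (Idx d) (Idx d) ℝ)
    (hA : IsSymplectic A) (hpolar : A = O * P)
    (hO : Oᵀ * O = 1) (hPsymm : Pᵀ = P) (hPpos : P.PosDef)
    (hclean : {v : Idx d → ℝ | A.mulVec v = v} ∩
        {v : Idx d → ℝ | ∃ x : Idx d → ℝ, (1 - A).mulVec x = v} = {0})
    (w₀ : Idx d → ℝ) (hw₀ : A.mulVec w₀ = w₀) :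
    ∃ C > (0 : ℝ), ∀ (u : Idx d → ℝ) (τ : ℝ),
      (∃ x : Idx d → ℝ, (1 - A).mulVec x = u) →
      (SA A O P u (τ • w₀ + u)).re =
          -(((A - 1).mulVec u - τ • w₀) ⬝ᵥ
              (PA O P).mulVec ((A - 1).mulVec u - τ • w₀)) ∧
      (SA A O P u (τ • w₀ + u)).re ≤ -(C * (u ⬝ᵥ u + τ ^ 2 * (w₀ ⬝ᵥ w₀))) := by
  have hL : ∀ (u : Idx d → ℝ) (τ : ℝ),
      LA A u (τ • w₀ + u) = (A - 1).mulVec u - τ • w₀ := fun u τ => by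
    rw [LA, sub_mulVec, one_mulVec]; abel
  have hre : ∀ (u : Idx d → ℝ) (τ : ℝ), (SA A O P u (τ • w₀ + u)).re =
      -(((A - 1).mulVec u - τ • w₀) ⬝ᵥ
        (PA O P).mulVec ((A - 1).mulVec u - τ • w₀)) := fun u τ => by
    rw [← hL]; simp [SA]
  have hclean' : ∀ v x : Idx d → ℝ, A *ᵥ v = v → (1 - A) *ᵥ x = v → v = 0 := fun v x h1 h2 =>
    hclean.subset ⟨h1, x, h2⟩
  let V : Submodule ℝ (Idx d → ℝ) := LinearMap.range (1 - A).mulVecLin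
  let W : Submodule ℝ (Idx d → ℝ) := LinearMap.ker (1 - A).mulVecLin
  have hW : ∀ v : Idx d → ℝ, v ∈ W ↔ A *ᵥ v = v := fun v => by
    simp [W, sub_eq_zero, eq_comm]
  let f : V × W →ₗ[ℝ] (Idx d → ℝ) :=
    ((A - 1).mulVecLin ∘ₗ V.subtype).coprod (-W.subtype)
  have hfapp : ∀ z : V × W, f z = (A - 1) *ᵥ (z.1 : Idx d → ℝ) - (z.2 : Idx d → ℝ) := fun z => by
    simp [f, sub_mulVec, ← sub_eq_add_neg]
  have hf : Function.Injective f := by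
    refine (injective_iff_map_eq_zero f).2 ?_
    rintro ⟨⟨u, x, hx⟩, ⟨v, hv⟩⟩ hz
    rw [hfapp] at hz
    have hAu : (A - 1) *ᵥ u = v := sub_eq_zero.1 hz
    have hv0 : v = 0 := hclean' v (-u) ((hW v).1 hv) (by
      rw [← hAu, mulVec_neg, ← neg_mulVec, neg_sub])
    have hu0 : u = 0 := hclean' u x (by
      rwa [hv0, sub_mulVec, one_mulVec, sub_eq_zero] at hAu) hx
    subst hv0 hu0
    rfl
  obtain ⟨C, hC, hle⟩ := exists_coercive_of_posDef_of_injective (posDef_PA hO hPsymm) f hf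
  refine ⟨C, hC, fun u τ hu => ⟨hre u τ, ?_⟩⟩
  have h := hle (⟨u, hu⟩, ⟨τ • w₀, (hW _).2 (by rw [mulVec_smul, hw₀])⟩)
  rw [hfapp] at h
  simp only [smul_dotProduct, dotProduct_smul, smul_eq_mul, ← mul_assoc, ← sq] at h
  rw [hre]
  exact neg_le_neg h
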